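/- (Theorem 4) Let A be a random M×N matrix over F_q drawn from the row-erasure model, with M ≥ N ≥ 1. Then the probability of decoding failure P_fail := Pr(rank(A) < N) satisfies P_fail ≥ Σ_{r=0}^{M} C(M,r)·ε_RD^{M−r}·(1−ε_RD)^r·max{η_min(N,r), P_0(N,r)}, where for r ≥ N, η_min(N,r) = 1 − Π_{i=1}^{N}(1 − β_min^{r−i+1}) with β_min = min(ε_SR, (1−ε_SR)/(q−1)), η_min(N,r) = 1 for r < N, and P_0(N,r) = Σ_{k=1}^{N} C(N,k)·(ε_SR^r)^k·(1 − ε_SR^r)^{N−k}. -/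

import Mathlib

open Finset
open scoped Classical

noncomputable section

/-- The entry distribution μ on the finite field `F`: the value `0` has
probability `ε_SR` and each nonzero value has probability `(1-ε_SR)/(q-1)`,
where `q = |F|`. -/
def muDist (F : Type*) [Field F] [Fintype F] [DecidableEq F] (εSR : ℝ) (t : F) : ℝ :=
  if t = 0 then εSR else (1 - εSR) / ((Fintype.card F : ℝ) - 1)

/-- Row distribution of the row-erasure model: a row is the zero row with
probability `ε_RD`, and otherwise consists of `N` i.i.d. `μ`-distributed entries. -/
def reRowProb (F : Type*) [Field F] [Fintype F] [DecidableEq F] (εSR εRD : ℝ) {N : ℕ}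
    (v : Fin N → F) : ℝ :=
  (if v = 0 then εRD else 0) + (1 - εRD) * ∏ j, muDist F εSR (v j)

/-- The probability that a random `M × N` matrix drawn from the row-erasure model
(independent rows, each distributed as `reRowProb`) equals the fixed matrix `A`. -/
def reMatProb (F : Type*) [Field F] [Fintype F] [DecidableEq F] (εSR εRD : ℝ) {M N : ℕ}
    (A : Matrix (Fin M) (Fin N) F) : ℝ :=
  ∏ i, reRowProb F εSR εRD (A i)

/-- `P_0(N,r) = Σ_{k=1}^{N} C(N,k)·(ε_SR^r)^k·(1 − ε_SR^r)^{N−k}`. -/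
def P0 (εSR : ℝ) (N r : ℕ) : ℝ :=
  ∑ k ∈ Icc 1 N, (N.choose k : ℝ) * (εSR ^ r) ^ k * (1 - εSR ^ r) ^ (N - k)

/-- `η_min(N,r) = 1 − Π_{i=1}^{N}(1 − β_min^{r−i+1})` for `r ≥ N`, with the
convention `η_min(N,r) = 1` for `r < N`, where `β_min = min(ε_SR, (1−ε_SR)/(q−1))`. -/
def etaMin (q εSR : ℝ) (N r : ℕ) : ℝ :=
  if N ≤ r then
    1 - ∏ i ∈ Icc 1 N, (1 - (min εSR ((1 - εSR) / (q - 1))) ^ (r - i + 1))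
  else 1

lemma sum_pi_prod_eq_one {ι κ : Type*} [Fintype ι] [DecidableEq ι] [Fintype κ] (f : ι → κ → ℝ)
    (hf : ∀ i, ∑ t, f i t = 1) : ∑ v : ι → κ, ∏ i, f i (v i) = 1 := by
  rw [← Fintype.piFinset_univ, ← prod_univ_sum]
  simp [hf]

/-- If `single i 1 ∉ V` and the `i`-th coordinate takes every value with weight at least `β`, then
adjoining `single i 1` to `V` multiplies its weight by at most `β⁻¹`. -/
lemma mul_weight_sup_span_single_le {F ι : Type*} [Field F] [Fintype F] [Fintype ι] [DecidableEq ι]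
    (ν : ι → F → ℝ) (hν : ∀ i t, 0 ≤ ν i t) (V : Submodule F (ι → F)) (i : ι)
    (hsum : ∑ t, ν i t = 1) (β : ℝ) (hβ : ∀ t, β ≤ ν i t)
    (hi : (Pi.single i 1 : ι → F) ∉ V) :
    β * ∑ v : ι → F with v ∈ V ⊔ Submodule.span F {(Pi.single i 1 : ι → F)}, ∏ j, ν j (v j) ≤
      ∑ v : ι → F with v ∈ V, ∏ j, ν j (v j) := by
  set g : (ι → F) → ℝ := fun v ↦ ∏ j ∈ univ.erase i, ν j (v j)
  have hsplit (v : ι → F) : ∏ j, ν j (v j) = ν i (v i) * g v :=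
    (mul_prod_erase univ (fun j ↦ ν j (v j)) (mem_univ i)).symm
  have hshift (u : ι → F) (t : F) : g (u + t • Pi.single i 1) = g u := by
    refine prod_congr rfl fun j hj ↦ ?_
    simp [Pi.single_eq_of_ne (ne_of_mem_erase hj)]
  have hinj : Set.InjOn (fun p : (ι → F) × F ↦ p.1 + p.2 • (Pi.single i 1 : ι → F))
      (((univ.filter (· ∈ V)) ×ˢ univ : Finset ((ι → F) × F)) : Set ((ι → F) × F)) := by
    rintro ⟨u, s⟩ hu ⟨v, t⟩ hv h
    simp only [coe_product, coe_filter, mem_univ, true_and, coe_univ, Set.mem_prod,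
      Set.mem_ofPred_eq, Set.mem_univ, and_true] at hu hv h
    have hst : s = t := by
      by_contra hne
      refine hi ((V.smul_mem_iff (sub_ne_zero.2 hne)).1 ?_)
      have : (s - t) • (Pi.single i 1 : ι → F) = v - u := by
        rw [sub_smul, sub_eq_sub_iff_add_eq_add, add_comm, h]
      exact this ▸ V.sub_mem hv hu
    subst hst
    simpa using h
  have himage : (univ.filter fun v : ι → F ↦ v ∈ V ⊔ Submodule.span F {(Pi.single i 1 : ι → F)}) =
      ((univ.filter (· ∈ V)) ×ˢ univ).image
        (fun p : (ι → F) × F ↦ p.1 + p.2 • (Pi.single i 1 : ι → F)) := by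
    ext v
    simp only [mem_filter, mem_univ, true_and, mem_image, mem_product, and_true, Prod.exists,
      Submodule.mem_sup, Submodule.mem_span_singleton]
    constructor
    · rintro ⟨u, hu, _, ⟨t, rfl⟩, rfl⟩
      exact ⟨u, t, hu, rfl⟩
    · rintro ⟨u, t, hu, rfl⟩
      exact ⟨u, hu, _, ⟨t, rfl⟩, rfl⟩
  rw [himage, sum_image hinj, sum_product, mul_sum]
  refine sum_le_sum fun u _ ↦ ?_
  have hfiber : ∑ t : F, ∏ j, ν j ((u + t • (Pi.single i 1 : ι → F)) j) = g u := by
    simp_rw [hsplit, hshift, ← sum_mul]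
    simp only [Pi.add_apply, Pi.smul_apply, Pi.single_eq_same, smul_eq_mul, mul_one]
    rw [Fintype.sum_equiv (Equiv.addLeft (u i)) (fun t ↦ ν i (u i + t)) (ν i) fun _ ↦ rfl, hsum,
      one_mul]
  rw [hfiber, hsplit]
  exact mul_le_mul_of_nonneg_right (hβ _) (prod_nonneg fun j _ ↦ hν _ _)

lemma finrank_le_card_of_support_subset {F ι : Type*} [Field F] [Fintype ι]
    (S : Finset ι) (V : Submodule F (ι → F)) (hV : ∀ v ∈ V, ∀ i ∉ S, v i = 0) :
    Module.finrank F V ≤ #S := by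
  suffices hinj : Function.Injective ((LinearMap.funLeft F F ((↑) : S → ι)).comp V.subtype) by
    simpa using LinearMap.finrank_le_finrank_of_injective hinj
  refine (injective_iff_map_eq_zero _).2 fun v hv ↦ Subtype.ext (funext fun i ↦ ?_)
  by_cases hi : i ∈ S
  · exact congrFun hv ⟨i, hi⟩
  · exact hV v v.2 i hi

/-- A random vector supported on the coordinates in `S`, all of whose values there have weight at
least `β`, lies in a subspace of codimension at most `n` with probability at least `β ^ n`. -/
lemma pow_le_weight_submodule {F ι : Type*} [Field F] [Fintype F] [Fintype ι] [DecidableEq ι]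
    (ν : ι → F → ℝ) (hν : ∀ i t, 0 ≤ ν i t) (hsum : ∀ i, ∑ t, ν i t = 1)
    (S : Finset ι) (hS : ∀ i ∉ S, ∀ t ≠ 0, ν i t = 0)
    (β : ℝ) (hβ0 : 0 ≤ β) (hβ1 : β ≤ 1) (hβ : ∀ i ∈ S, ∀ t, β ≤ ν i t) (n : ℕ)
    (V : Submodule F (ι → F)) (hV : ∀ v ∈ V, ∀ i ∉ S, v i = 0)
    (hn : #S ≤ Module.finrank F V + n) :
    β ^ n ≤ ∑ v : ι → F with v ∈ V, ∏ j, ν j (v j) := by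
  induction n using Nat.strong_induction_on generalizing V with
  | _ n ih =>
  by_cases h : ∀ i ∈ S, (Pi.single i 1 : ι → F) ∈ V
  · have hmem (v : ι → F) (hv : ∀ i ∉ S, v i = 0) : v ∈ V := by
      rw [← univ_sum_single v]
      refine V.sum_mem fun i _ ↦ ?_
      by_cases hi : i ∈ S
      · simpa [← Pi.single_smul] using V.smul_mem (v i) (h i hi)
      · simp [hv i hi]
    refine (pow_le_one₀ hβ0 hβ1).trans ?_
    rw [← sum_pi_prod_eq_one ν hsum, sum_filter]
    refine (sum_congr rfl fun v _ ↦ ?_).le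
    split_ifs with hv
    · rfl
    · have : ∃ i ∉ S, v i ≠ 0 := by
        by_contra! h0
        exact hv (hmem v h0)
      obtain ⟨i, hi, hvi⟩ := this
      exact prod_eq_zero (mem_univ i) (hS i hi _ hvi)
  · push Not at h
    obtain ⟨i, hiS, hi⟩ := h
    have hlt : V < V ⊔ Submodule.span F {(Pi.single i 1 : ι → F)} :=
      lt_of_le_of_ne le_sup_left fun heq ↦
        hi (heq ▸ Submodule.mem_sup_right (Submodule.mem_span_singleton_self _))
    have hrank := Submodule.finrank_lt_finrank_of_lt hlt
    have hsupp : ∀ v ∈ V ⊔ Submodule.span F {(Pi.single i 1 : ι → F)}, ∀ j ∉ S, v j = 0 := by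
      intro v hv j hj
      obtain ⟨u, hu, _, ht, rfl⟩ := Submodule.mem_sup.1 hv
      obtain ⟨t, rfl⟩ := Submodule.mem_span_singleton.1 ht
      have hji : j ≠ i := fun hji ↦ hj (hji ▸ hiS)
      simp [hV u hu j hj, Pi.single_eq_of_ne hji]
    have hcard := finrank_le_card_of_support_subset S _ hsupp
    obtain ⟨m, rfl⟩ : ∃ m, n = m + 1 := ⟨n - 1, by omega⟩
    rw [pow_succ']
    exact (mul_le_mul_of_nonneg_left (ih m m.lt_succ_self _ hsupp (by omega)) hβ0).trans
      (mul_weight_sup_span_single_le ν hν V i (hsum i) β (hβ i hiS) hi)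

/-- If, given any `k` independent vectors in the support of `w`, a further vector lies in their span
with probability at least `b k`, then `N` vectors are independent with probability at most
`∏ k < N, (1 - b k)`. -/
lemma sum_linearIndependent_le {F W : Type*} [Field F] [AddCommGroup W] [Module F W] [Fintype W]
    (w : W → ℝ) (hw : ∀ v, 0 ≤ w v) (hsum : ∑ v, w v = 1) (b : ℕ → ℝ) (hb1 : ∀ k, b k ≤ 1)
    (hb : ∀ (k : ℕ) (c : Fin k → W), LinearIndependent F c → (∀ j, w (c j) ≠ 0) →
      b k ≤ ∑ v with v ∈ Submodule.span F (Set.range c), w v) (N : ℕ) :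
    ∑ c : Fin N → W with LinearIndependent F c, ∏ j, w (c j) ≤ ∏ k ∈ range N, (1 - b k) := by
  induction N with
  | zero =>
    rw [sum_filter]
    simp
  | succ N ih =>
    have hcons (c : Fin N → W) :
        ∑ v, (if LinearIndependent F (Fin.cons v c : Fin (N + 1) → W)
          then w v * ∏ j, w (c j) else 0) ≤
        (if LinearIndependent F c then ∏ j, w (c j) else 0) * (1 - b N) := by
      have hp : 0 ≤ ∏ j, w (c j) := prod_nonneg fun j _ ↦ hw _
      by_cases hc : LinearIndependent F c
      · by_cases h0 : ∀ j, w (c j) ≠ 0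
        · have hcompl := sum_filter_add_sum_filter_not univ
            (fun v ↦ v ∈ Submodule.span F (Set.range c)) w
          have hstep := hb N c hc h0
          simp only [linearIndependent_finCons, hc, true_and, if_true]
          rw [← sum_filter, ← sum_mul, mul_comm]
          exact mul_le_mul_of_nonneg_left (by linarith) hp
        · push Not at h0
          obtain ⟨j, hj⟩ := h0
          simp [prod_eq_zero (f := fun j ↦ w (c j)) (mem_univ j) hj]
      · simp [linearIndependent_finCons, hc]
    rw [sum_filter, ← (Fin.consEquiv fun _ ↦ W).sum_comp, Fintype.sum_prod_type_right]
    simp only [Fin.consEquiv_apply, Fin.prod_univ_succ, Fin.cons_zero, Fin.cons_succ]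
    refine (sum_le_sum fun c _ ↦ hcons c).trans ?_
    rw [← sum_mul, ← sum_filter, prod_range_succ]
    exact mul_le_mul_of_nonneg_right ih (sub_nonneg.2 (hb1 N))

lemma rank_lt_iff_not_linearIndependent_cols {F ι : Type*} [Field F] [Fintype ι] {N : ℕ}
    (A : Matrix ι (Fin N) F) : A.rank < N ↔ ¬ LinearIndependent F A.col := by
  rw [linearIndependent_iff_card_le_finrank_span, Fintype.card_fin, not_le,
    Matrix.rank_eq_finrank_span_cols]
  rfl

/-- The distribution of an entry of row `i` of the row-erasure model, given that `S` is the set of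
rows that are not erased. -/
def entryDist (F : Type*) [Field F] [Fintype F] [DecidableEq F] (εSR : ℝ) {M : ℕ}
    (S : Finset (Fin M)) (i : Fin M) (t : F) : ℝ :=
  if i ∈ S then muDist F εSR t else if t = 0 then 1 else 0

lemma sum_muDist (F : Type*) [Field F] [Fintype F] [DecidableEq F] (εSR : ℝ) :
    ∑ t, muDist F εSR t = 1 := by
  have hq : (1 : ℝ) < Fintype.card F := mod_cast Fintype.one_lt_card
  have hq' : (Fintype.card F : ℝ) - 1 ≠ 0 := by linarith
  simp only [muDist]
  rw [sum_ite, sum_const, sum_const, filter_eq' univ (0 : F), filter_ne' univ (0 : F),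
    card_erase_of_mem (mem_univ _), card_univ]
  simp only [mem_univ, if_true, card_singleton, one_smul, nsmul_eq_mul]
  rw [Nat.cast_sub Fintype.card_pos, Nat.cast_one]
  field_simp
  ring

lemma muDist_nonneg {F : Type*} [Field F] [Fintype F] [DecidableEq F] {εSR : ℝ}
    (hεSR : εSR ∈ Set.Icc (0 : ℝ) 1) (t : F) : 0 ≤ muDist F εSR t := by
  have hq : (1 : ℝ) < Fintype.card F := mod_cast Fintype.one_lt_card
  unfold muDist
  split_ifs
  · exact hεSR.1
  · exact div_nonneg (by linarith [hεSR.2]) (by linarith)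

lemma entryDist_nonneg {F : Type*} [Field F] [Fintype F] [DecidableEq F] {εSR : ℝ}
    (hεSR : εSR ∈ Set.Icc (0 : ℝ) 1) {M : ℕ} (S : Finset (Fin M)) (i : Fin M) (t : F) :
    0 ≤ entryDist F εSR S i t := by
  unfold entryDist
  split_ifs
  exacts [muDist_nonneg hεSR t, zero_le_one, le_rfl]

lemma sum_entryDist (F : Type*) [Field F] [Fintype F] [DecidableEq F] (εSR : ℝ) {M : ℕ}
    (S : Finset (Fin M)) (i : Fin M) : ∑ t, entryDist F εSR S i t = 1 := by
  by_cases hi : i ∈ S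
  · simp [entryDist, hi, sum_muDist]
  · simp [entryDist, hi]

/-- The row-erasure model is a mixture, over the set `S` of rows that are not erased, of models with
independent entries. -/
lemma reMatProb_eq_sum (F : Type*) [Field F] [Fintype F] [DecidableEq F] (εSR εRD : ℝ) {M N : ℕ}
    (A : Matrix (Fin M) (Fin N) F) :
    reMatProb F εSR εRD A = ∑ S : Finset (Fin M), (εRD ^ (M - #S) * (1 - εRD) ^ #S) *
      ∏ j, ∏ i, entryDist F εSR S i (A i j) := by
  have herased (i : Fin M) : (if A i = 0 then εRD else 0) =
      εRD * ∏ j, (if A i j = 0 then (1 : ℝ) else 0) := by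
    rw [Fintype.prod_boole]
    simp [funext_iff]
  simp only [reMatProb, reRowProb]
  simp_rw [add_comm (ite _ _ _), herased]
  rw [Fintype.prod_add]
  refine sum_congr rfl fun S _ ↦ ?_
  rw [prod_comm, ← prod_mul_prod_compl S (fun i ↦ ∏ j, entryDist F εSR S i (A i j)),
    prod_mul_distrib, prod_mul_distrib, prod_const, prod_const, card_compl, Fintype.card_fin]
  have h1 : ∏ i ∈ S, ∏ j, entryDist F εSR S i (A i j) = ∏ i ∈ S, ∏ j, muDist F εSR (A i j) :=
    prod_congr rfl fun i hi ↦ by simp [entryDist, hi]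
  have h2 : ∏ i ∈ Sᶜ, ∏ j, entryDist F εSR S i (A i j) =
      ∏ i ∈ Sᶜ, ∏ j, (if A i j = 0 then (1 : ℝ) else 0) :=
    prod_congr rfl fun i hi ↦ by simp [entryDist, mem_compl.1 hi]
  rw [h1, h2]
  ring

lemma P0_eq (εSR : ℝ) (N r : ℕ) : P0 εSR N r = 1 - (1 - εSR ^ r) ^ N := by
  have h := add_pow (εSR ^ r) (1 - εSR ^ r) N
  rw [add_sub_cancel, one_pow, sum_range_succ'] at h
  have hshift : P0 εSR N r = ∑ k ∈ range N,
      (εSR ^ r) ^ (k + 1) * (1 - εSR ^ r) ^ (N - (k + 1)) * (N.choose (k + 1) : ℝ) := by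
    rw [P0, ← Ico_add_one_right_eq_Icc, sum_Ico_eq_sum_range]
    refine sum_congr (by simp) fun k _ ↦ ?_
    rw [add_comm 1 k]
    ring
  rw [hshift, eq_sub_iff_add_eq]
  simpa using h.symm

lemma etaMin_le (q εSR : ℝ) (N r : ℕ) :
    etaMin q εSR N r ≤
      1 - ∏ k ∈ range N, (1 - (min εSR ((1 - εSR) / (q - 1))) ^ (r - k)) := by
  unfold etaMin
  split_ifs with h
  · refine (congrArg (1 - ·) ?_).le
    rw [← Ico_add_one_right_eq_Icc, prod_Ico_eq_prod_range]
    refine prod_congr (by simp) fun k hk ↦ ?_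
    rw [mem_range] at hk
    congr 2
    omega
  · rw [prod_eq_zero (mem_range.2 (not_le.1 h)) (by simp), sub_zero]

lemma sum_rank_lt_eq {F ι : Type*} [Field F] [Fintype F] [Fintype ι] [DecidableEq ι] (N : ℕ)
    (w : (ι → F) → ℝ) (hsum : ∑ v, w v = 1) :
    ∑ A : Matrix ι (Fin N) F with A.rank < N, ∏ j, w (A.col j) =
      1 - ∑ c : Fin N → ι → F with LinearIndependent F c, ∏ j, w (c j) := by
  have htotal := sum_pi_prod_eq_one (fun _ : Fin N ↦ w) fun _ ↦ hsum
  rw [← sum_filter_add_sum_filter_not univ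
    (fun c : Fin N → ι → F ↦ LinearIndependent F c)] at htotal
  rw [eq_sub_iff_add_eq, ← htotal, add_comm]
  congr 1
  rw [sum_filter, sum_filter]
  refine Fintype.sum_equiv (Equiv.piComm fun _ _ ↦ F) _
    (fun c : Fin N → ι → F ↦ if ¬ LinearIndependent F c then ∏ j, w (c j) else 0) fun A ↦ ?_
  exact if_congr (rank_lt_iff_not_linearIndependent_cols A) rfl rfl

lemma sum_linearIndependent_le_one_sub_etaMin {F : Type*} [Field F] [Fintype F] [DecidableEq F]
    {εSR : ℝ} (hεSR : εSR ∈ Set.Icc (0 : ℝ) 1) {M : ℕ} (N : ℕ) (S : Finset (Fin M)) :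
    ∑ c : Fin N → Fin M → F with LinearIndependent F c, ∏ j, ∏ i, entryDist F εSR S i (c j i) ≤
      1 - etaMin (Fintype.card F : ℝ) εSR N #S := by
  refine le_trans ?_ (le_sub_comm.1 (etaMin_le _ _ _ _))
  have hq : (1 : ℝ) < Fintype.card F := mod_cast Fintype.one_lt_card
  have hβ0 : 0 ≤ min εSR ((1 - εSR) / ((Fintype.card F : ℝ) - 1)) :=
    le_min hεSR.1 (div_nonneg (by linarith [hεSR.2]) (by linarith))
  have hβ1 : min εSR ((1 - εSR) / ((Fintype.card F : ℝ) - 1)) ≤ 1 :=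
    (min_le_left _ _).trans hεSR.2
  have hβ (i) (hi : i ∈ S) (t : F) :
      min εSR ((1 - εSR) / ((Fintype.card F : ℝ) - 1)) ≤ entryDist F εSR S i t := by
    simp only [entryDist, hi, if_true, muDist]
    split_ifs
    exacts [min_le_left _ _, min_le_right _ _]
  generalize min εSR ((1 - εSR) / ((Fintype.card F : ℝ) - 1)) = β at hβ0 hβ1 hβ ⊢
  have hS (i) (hi : i ∉ S) (t : F) (ht : t ≠ 0) : entryDist F εSR S i t = 0 := by
    simp [entryDist, hi, ht]
  refine sum_linearIndependent_le (F := F) (fun v : Fin M → F ↦ ∏ i, entryDist F εSR S i (v i))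
    (fun v ↦ prod_nonneg fun i _ ↦ entryDist_nonneg hεSR S i _)
    (sum_pi_prod_eq_one _ (sum_entryDist F εSR S)) (fun k ↦ β ^ (#S - k))
    (fun k ↦ pow_le_one₀ hβ0 hβ1) (fun k c hc hcw ↦ ?_) N
  refine pow_le_weight_submodule _ (entryDist_nonneg hεSR S) (sum_entryDist F εSR S) S hS β hβ0
    hβ1 hβ _ _ (fun v hv i hi ↦ ?_) ?_
  · induction hv using Submodule.span_induction with
    | mem v hv =>
      obtain ⟨j, rfl⟩ := hv
      by_contra h
      exact hcw j (prod_eq_zero (mem_univ i) (hS i hi _ h))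
    | zero => rfl
    | add u v _ _ hu hv => simp [hu, hv]
    | smul t v _ hv => simp [hv]
  · rw [finrank_span_eq_card hc, Fintype.card_fin]
    omega

lemma sum_linearIndependent_le_one_sub_P0 {F : Type*} [Field F] [Fintype F] [DecidableEq F]
    {εSR : ℝ} (hεSR : εSR ∈ Set.Icc (0 : ℝ) 1) {M : ℕ} (N : ℕ) (S : Finset (Fin M)) :
    ∑ c : Fin N → Fin M → F with LinearIndependent F c, ∏ j, ∏ i, entryDist F εSR S i (c j i) ≤
      1 - P0 εSR N #S := by
  have hzero : ∏ i, entryDist F εSR S i ((0 : Fin M → F) i) = εSR ^ #S := by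
    simp [entryDist, muDist]
  have hw (v : Fin M → F) : 0 ≤ ∏ i, entryDist F εSR S i (v i) :=
    prod_nonneg fun i _ ↦ entryDist_nonneg hεSR S i _
  rw [P0_eq, sub_sub_cancel, ← card_range N, ← prod_const, card_range]
  exact sum_linearIndependent_le (F := F) (fun v : Fin M → F ↦ ∏ i, entryDist F εSR S i (v i)) hw
    (sum_pi_prod_eq_one _ (sum_entryDist F εSR S)) (fun _ ↦ εSR ^ #S)
    (fun _ ↦ pow_le_one₀ hεSR.1 hεSR.2)
    (fun k c _ _ ↦ hzero.symm.le.trans <|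
      single_le_sum (f := fun v : Fin M → F ↦ ∏ i, entryDist F εSR S i (v i))
        (fun v _ ↦ hw v) (by simp)) N

/-- The failure probability, given that `S` is the set of rows that are not erased, is at least
`max {η_min(N, |S|), P_0(N, |S|)}`. -/
lemma max_le_sum_rank_lt {F : Type*} [Field F] [Fintype F] [DecidableEq F] {εSR : ℝ}
    (hεSR : εSR ∈ Set.Icc (0 : ℝ) 1) {M : ℕ} (N : ℕ) (S : Finset (Fin M)) :
    max (etaMin (Fintype.card F : ℝ) εSR N #S) (P0 εSR N #S) ≤
      ∑ A : Matrix (Fin M) (Fin N) F with A.rank < N, ∏ j, ∏ i, entryDist F εSR S i (A i j) := by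
  refine le_of_le_of_eq ?_ (sum_rank_lt_eq N (fun v ↦ ∏ i, entryDist F εSR S i (v i))
    (sum_pi_prod_eq_one _ (sum_entryDist F εSR S))).symm
  exact max_le (le_sub_comm.1 (sum_linearIndependent_le_one_sub_etaMin hεSR N S))
    (le_sub_comm.1 (sum_linearIndependent_le_one_sub_P0 hεSR N S))

/-- Theorem 4: for a random `M × N` matrix `A` over `F_q` drawn from
the row-erasure model, with `M ≥ N ≥ 1`, the probability of decoding failure
`P_fail := Pr(rank(A) < N)` satisfies
`P_fail ≥ Σ_{r=0}^{M} C(M,r)·ε_RD^{M−r}·(1−ε_RD)^r·max{η_min(N,r), P_0(N,r)}`. -/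
theorem stmt_15 (F : Type*) [Field F] [Fintype F] [DecidableEq F]
    (hq : 2 ≤ Fintype.card F)
    (εSR : ℝ) (hεSR : εSR ∈ Set.Icc (0 : ℝ) 1)
    (εRD : ℝ) (hεRD : εRD ∈ Set.Icc (0 : ℝ) 1)
    (M N : ℕ) (hN : 1 ≤ N) (hMN : N ≤ M) :
    (∑ r ∈ range (M + 1), (M.choose r : ℝ) * εRD ^ (M - r) * (1 - εRD) ^ r *
        max (etaMin (Fintype.card F : ℝ) εSR N r) (P0 εSR N r)) ≤
      ∑ A : Matrix (Fin M) (Fin N) F,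
        if A.rank < N then reMatProb F εSR εRD A else 0 := by
  rw [← sum_filter]
  simp_rw [reMatProb_eq_sum]
  rw [sum_comm]
  have hgroup := sum_powerset_apply_card (fun r ↦ εRD ^ (M - r) * (1 - εRD) ^ r *
    max (etaMin (Fintype.card F : ℝ) εSR N r) (P0 εSR N r)) (x := (univ : Finset (Fin M)))
  simp only [powerset_univ, card_univ, Fintype.card_fin, nsmul_eq_mul] at hgroup
  simp_rw [mul_assoc] at hgroup ⊢
  rw [← hgroup]
  refine sum_le_sum fun S _ ↦ ?_
  simp_rw [← mul_assoc]
  rw [← mul_sum]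
  exact mul_le_mul_of_nonneg_left (max_le_sum_rank_lt hεSR N S)
    (mul_nonneg (pow_nonneg hεRD.1 _) (pow_nonneg (sub_nonneg.2 hεRD.2) _))
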